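/- First-order expansion of the conjectured minimum distance (equation (34)): Fix an integer T ≥ 2. With φ = φ(B0) = arctan(m1/m0), one has lim_{B0 → ∞} d̃(T,B0) / |φ(B0)| = 2·sqrt(T−1)/T. -/

import Mathlib

open MeasureTheory Filter
open scoped BigOperators

/-- The standard normal cumulative distribution function. -/
noncomputable def stdNormalCDF (x : ℝ) : ℝ :=
  ∫ t in Set.Iic x, (Real.sqrt (2 * Real.pi))⁻¹ * Real.exp (-t ^ 2 / 2)

/-- The conjectured minimum distance `d̃(T,B0)`, expressed via the quantiles
`m0`, `m1`. -/
noncomputable def dtilde (T : ℕ) (m0 m1 : ℝ) : ℝ :=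
  let α : ℝ := (1 - Real.exp (-(m0 ^ 2 + m1 ^ 2) / 2)) / (1 + Real.exp (-(m0 ^ 2 + m1 ^ 2) / 2))
  let β : ℝ := 1 + ((T : ℝ) - 2) * (1 - Real.exp (-m0 ^ 2)) / (1 + Real.exp (-m0 ^ 2))
  let φ : ℝ := Real.arctan (m1 / m0)
  Real.sqrt (1 - ‖(1 : ℂ) + ((α / (α + β) : ℝ) : ℂ) *
    (Complex.exp (2 * Complex.I * (φ : ℂ)) - 1)‖ ^ 2)

theorem integrable_stdNormal_density :
    Integrable fun t : ℝ => (Real.sqrt (2 * Real.pi))⁻¹ * Real.exp (-t ^ 2 / 2) := by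
  have h := (integrable_exp_neg_mul_sq (b := 1 / 2) (by norm_num)).const_mul
    (Real.sqrt (2 * Real.pi))⁻¹
  refine h.congr (Eventually.of_forall fun t => ?_)
  simp only
  congr 2
  ring

theorem strictMono_stdNormalCDF : StrictMono stdNormalCDF := by
  intro x y hxy
  have hsub := intervalIntegral.integral_Iic_sub_Iic
    (integrable_stdNormal_density.integrableOn (s := Set.Iic x))
    (integrable_stdNormal_density.integrableOn (s := Set.Iic y))
  have hpos : 0 < ∫ t in x..y, (Real.sqrt (2 * Real.pi))⁻¹ * Real.exp (-t ^ 2 / 2) :=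
    intervalIntegral.intervalIntegral_pos_of_pos
      integrable_stdNormal_density.intervalIntegrable (fun t => by positivity) hxy
  unfold stdNormalCDF
  linarith

theorem stdNormalCDF_nonneg (x : ℝ) : 0 ≤ stdNormalCDF x :=
  integral_nonneg fun t => by positivity

theorem stdNormalCDF_pos (x : ℝ) : 0 < stdNormalCDF x :=
  (stdNormalCDF_nonneg (x - 1)).trans_lt (strictMono_stdNormalCDF (by linarith))

theorem stdNormalCDF_zero : stdNormalCDF 0 = 1 / 2 := by
  have h := integral_gaussian_Ioi (1 / 2)
  have h2 := integral_comp_neg_Iic (0 : ℝ) fun t : ℝ => Real.exp (-(1 / 2) * t ^ 2)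
  rw [neg_zero, h] at h2
  have h3 : ∀ t : ℝ, -t ^ 2 / 2 = -(1 / 2) * (-t) ^ 2 := fun t => by ring
  have hpi : Real.sqrt (2 * Real.pi) ≠ 0 := by positivity
  unfold stdNormalCDF
  simp_rw [h3]
  rw [integral_const_mul, h2, show Real.pi / (1 / 2) = 2 * Real.pi by ring]
  field_simp

theorem normSq_one_add_mul_exp_sub_one (c φ : ℝ) :
    ‖(1 : ℂ) + (c : ℂ) * (Complex.exp (2 * Complex.I * (φ : ℂ)) - 1)‖ ^ 2 =
      1 - 4 * (c * (1 - c)) * Real.sin φ ^ 2 := by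
  rw [show 2 * Complex.I * (φ : ℂ) = ((2 * φ : ℝ) : ℂ) * Complex.I by push_cast; ring,
    Complex.exp_mul_I, ← Complex.ofReal_cos, ← Complex.ofReal_sin, ← Complex.normSq_eq_norm_sq,
    Complex.normSq_apply]
  simp only [Complex.add_re, Complex.add_im, Complex.mul_re, Complex.mul_im, Complex.sub_re,
    Complex.sub_im, Complex.ofReal_re, Complex.ofReal_im, Complex.I_re, Complex.I_im,
    Complex.one_re, Complex.one_im]
  rw [Real.cos_two_mul, Real.sin_two_mul, Real.cos_sq']
  have h := Real.sin_sq_add_cos_sq φ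
  linear_combination (4 * c ^ 2 * Real.sin φ ^ 2) * h

/-- The weight `α / (α + β)` of the rotated component in `dtilde`. -/
noncomputable def rotationWeight (T : ℕ) (m0 m1 : ℝ) : ℝ :=
  let α : ℝ := (1 - Real.exp (-(m0 ^ 2 + m1 ^ 2) / 2)) / (1 + Real.exp (-(m0 ^ 2 + m1 ^ 2) / 2))
  let β : ℝ := 1 + ((T : ℝ) - 2) * (1 - Real.exp (-m0 ^ 2)) / (1 + Real.exp (-m0 ^ 2))
  α / (α + β)

theorem dtilde_eq (T : ℕ) (m0 m1 : ℝ) :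
    dtilde T m0 m1 =
      Real.sqrt (4 * (rotationWeight T m0 m1 * (1 - rotationWeight T m0 m1))) *
        |Real.sin (Real.arctan (m1 / m0))| := by
  have h : dtilde T m0 m1 = Real.sqrt (1 - ‖(1 : ℂ) + ((rotationWeight T m0 m1 : ℝ) : ℂ) *
      (Complex.exp (2 * Complex.I * (Real.arctan (m1 / m0) : ℂ)) - 1)‖ ^ 2) := rfl
  rw [h, normSq_one_add_mul_exp_sub_one, sub_sub_cancel, Real.sqrt_mul' _ (sq_nonneg _),
    Real.sqrt_sq_eq_abs]

theorem tendsto_rotationWeight {ι : Type*} {l : Filter ι} {T : ℕ} (hT : T ≠ 0) {m0 m1 : ι → ℝ}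
    (hm0 : Tendsto m0 l atBot) :
    Tendsto (fun i => rotationWeight T (m0 i) (m1 i)) l (nhds (1 / (T : ℝ))) := by
  have hsq : Tendsto (fun i => m0 i ^ 2) l atTop := by
    simpa only [pow_two] using hm0.atBot_mul_atBot₀ hm0
  have hadd : Tendsto (fun i => (m0 i ^ 2 + m1 i ^ 2) / 2) l atTop :=
    (tendsto_atTop_mono (fun i => le_add_of_nonneg_right (sq_nonneg (m1 i))) hsq).atTop_div_const
      two_pos
  have hexp0 : Tendsto (fun i => Real.exp (-m0 i ^ 2)) l (nhds 0) :=
    Real.tendsto_exp_neg_atTop_nhds_zero.comp hsq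
  have hexp1 : Tendsto (fun i => Real.exp (-(m0 i ^ 2 + m1 i ^ 2) / 2)) l (nhds 0) := by
    simpa only [Function.comp_def, neg_div] using Real.tendsto_exp_neg_atTop_nhds_zero.comp hadd
  have hα := (hexp1.const_sub 1).div (hexp1.const_add 1) (by norm_num)
  have hβ := (((hexp0.const_sub 1).const_mul ((T : ℝ) - 2)).div (hexp0.const_add 1)
    (by norm_num)).const_add 1
  have hT' : (T : ℝ) ≠ 0 := Nat.cast_ne_zero.mpr hT
  have hden : (1 - 0) / (1 + 0) + (1 + ((T : ℝ) - 2) * (1 - 0) / (1 + 0)) = T := by ring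
  have h := hα.div (hα.add hβ) (by rwa [hden])
  rw [hden, sub_zero, add_zero, div_one] at h
  exact h

theorem tendsto_abs_sin_div_abs {ι : Type*} {l : Filter ι} {φ : ι → ℝ}
    (hφ : Tendsto φ l (nhds 0)) (hne : ∀ᶠ i in l, φ i ≠ 0) :
    Tendsto (fun i => |Real.sin (φ i)| / |φ i|) l (nhds 1) := by
  have h := (Real.continuous_sinc.tendsto 0).comp hφ
  rw [Real.sinc_zero] at h
  have h' := h.abs
  rw [abs_one] at h'
  refine h'.congr' ?_
  filter_upwards [hne] with i hi
  rw [Function.comp_apply, Real.sinc_of_ne_zero hi, abs_div]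

theorem tendsto_two_rpow_neg_sub_one :
    Tendsto (fun B : ℕ => (2 : ℝ) ^ (-(B : ℝ) - 1)) atTop (nhds 0) := by
  have h := (tendsto_pow_atTop_nhds_zero_of_lt_one (r := (1 / 2 : ℝ)) (by norm_num)
    (by norm_num)).mul_const (1 / 2)
  rw [zero_mul] at h
  refine h.congr fun B => ?_
  rw [Real.rpow_sub two_pos, Real.rpow_neg two_pos.le, Real.rpow_natCast, Real.rpow_one]
  simp [div_eq_mul_inv]

/-- First-order expansion of the conjectured minimum distance (equation (34)):
`lim_{B0→∞} d̃(T,B0)/|φ(B0)| = 2√(T−1)/T`. -/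
theorem stmt_7 (T : ℕ) (hT : 2 ≤ T) (m0 m1 : ℕ → ℝ)
    (hm0 : ∀ B0 : ℕ, 1 ≤ B0 → stdNormalCDF (m0 B0) = (2 : ℝ) ^ (-(B0 : ℝ) - 1))
    (hm1 : ∀ B0 : ℕ, 1 ≤ B0 → stdNormalCDF (m1 B0) = 1 / 2 + (2 : ℝ) ^ (-(B0 : ℝ) - 1)) :
    Tendsto (fun B0 : ℕ => dtilde T (m0 B0) (m1 B0) / |Real.arctan (m1 B0 / m0 B0)|)
      atTop (nhds (2 * Real.sqrt ((T : ℝ) - 1) / (T : ℝ))) := by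
  have hm0_lim : Tendsto m0 atTop atBot := by
    refine tendsto_atBot.mpr fun M => ?_
    filter_upwards [eventually_ge_atTop 1,
      tendsto_two_rpow_neg_sub_one.eventually_lt_const (stdNormalCDF_pos M)] with B hB hlt
    exact (strictMono_stdNormalCDF.lt_iff_lt.mp (hm0 B hB ▸ hlt)).le
  have hm1_pos : ∀ᶠ B in atTop, 0 < m1 B := by
    filter_upwards [eventually_ge_atTop 1] with B hB
    refine strictMono_stdNormalCDF.lt_iff_lt.mp ?_
    rw [stdNormalCDF_zero, hm1 B hB]
    exact lt_add_of_pos_right _ (by positivity)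
  have hm1_lt : ∀ᶠ B in atTop, m1 B < 1 := by
    have h1 : 0 < stdNormalCDF 1 - 1 / 2 := by
      rw [← stdNormalCDF_zero]
      exact sub_pos.mpr (strictMono_stdNormalCDF one_pos)
    filter_upwards [eventually_ge_atTop 1,
      tendsto_two_rpow_neg_sub_one.eventually_lt_const h1] with B hB hlt
    refine strictMono_stdNormalCDF.lt_iff_lt.mp ?_
    rw [hm1 B hB]
    linarith
  have hratio : Tendsto (fun B => m1 B / m0 B) atTop (nhds 0) := by
    refine squeeze_zero_norm' ?_ (tendsto_inv_atTop_zero.comp (tendsto_abs_atBot_atTop.comp hm0_lim))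
    filter_upwards [hm1_pos, hm1_lt] with B hpos hlt
    rw [Real.norm_eq_abs, abs_div, abs_of_pos hpos, div_eq_mul_inv]
    exact mul_le_of_le_one_left (by positivity) hlt.le
  have hφ : Tendsto (fun B => Real.arctan (m1 B / m0 B)) atTop (nhds 0) := by
    simpa [Function.comp_def] using (Real.continuous_arctan.tendsto 0).comp hratio
  have hφ_ne : ∀ᶠ B in atTop, Real.arctan (m1 B / m0 B) ≠ 0 := by
    filter_upwards [hm1_pos, hm0_lim.eventually_lt_atBot 0] with B h1 h0
    exact Real.arctan_eq_zero_iff.not.mpr (div_ne_zero h1.ne' h0.ne)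
  have hw := tendsto_rotationWeight (m1 := m1) (show T ≠ 0 by omega) hm0_lim
  have hsqrt := ((hw.mul (hw.const_sub 1)).const_mul 4).sqrt
  have hT_pos : (0 : ℝ) < T := by positivity
  have hval : Real.sqrt (4 * (1 / (T : ℝ) * (1 - 1 / T))) = 2 * Real.sqrt ((T : ℝ) - 1) / T := by
    rw [show 4 * (1 / (T : ℝ) * (1 - 1 / T)) = (2 / T) ^ 2 * ((T : ℝ) - 1) by field_simp; ring,
      Real.sqrt_mul (sq_nonneg _), Real.sqrt_sq (by positivity)]
    ring
  have h := hsqrt.mul (tendsto_abs_sin_div_abs hφ hφ_ne)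
  rw [hval, mul_one] at h
  refine h.congr fun B => ?_
  rw [dtilde_eq, mul_div_assoc]
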